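/- arXiv:2302.12166 — 6 statements merged into one kernel-verified Lean document; each statement's English description precedes it below -/
import Mathlib

section
/- For every v ∈ ℝ one has v·σ'(v) < σ(v), where σ' denotes the derivative of σ. -/
theorem Real.hasDerivAt_tanh_inv_cosh_sq (x : ℝ) :
    HasDerivAt Real.tanh (1 / Real.cosh x ^ 2) x := by
  have hquot : Real.tanh = fun y => Real.sinh y / Real.cosh y :=
    funext Real.tanh_eq_sinh_div_cosh
  rw [hquot]
  refine ((Real.hasDerivAt_sinh x).div (Real.hasDerivAt_cosh x)
    (Real.cosh_pos x).ne').congr_deriv ?_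
  rw [← Real.cosh_sq_sub_sinh_sq x]
  ring

theorem Real.tanh_sub_div_cosh_sq_lt_one (x : ℝ) :
    Real.tanh x - x / Real.cosh x ^ 2 < 1 := by
  have hcosh := Real.cosh_pos x
  have hexp : Real.cosh x * (Real.cosh x - Real.sinh x) = (1 + Real.exp (-2 * x)) / 2 := by
    have hmul : Real.exp x * Real.exp (-x) = 1 := by rw [← Real.exp_add]; simp
    have hsq : Real.exp (-2 * x) = Real.exp (-x) * Real.exp (-x) := by
      rw [← Real.exp_add]; ring_nf
    rw [Real.cosh_sub_sinh, Real.cosh_eq, hsq]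
    linear_combination hmul / 2
  have hlin := Real.add_one_le_exp (-2 * x)
  have hform : Real.tanh x - x / Real.cosh x ^ 2
      = (Real.sinh x * Real.cosh x - x) / Real.cosh x ^ 2 := by
    rw [Real.tanh_eq_sinh_div_cosh]
    field_simp
  rw [hform, div_lt_one (by positivity)]
  linarith

/-- For `σ(v) = c₀ (1 - c₁ (1 + tanh(-v/c₂)))` with `c₀ > 0`,
`0 ≤ c₁ < 1/2` and `c₂ > 0`, one has `v σ'(v) < σ(v)` for every `v ∈ ℝ`. -/
theorem sigma_decompaction_v_mul_deriv_lt (c₀ c₁ c₂ : ℝ) (hc₀ : 0 < c₀) (hc₁ : 0 ≤ c₁)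
    (hc₁' : c₁ < 1 / 2) (hc₂ : 0 < c₂) (σ : ℝ → ℝ)
    (hσ : ∀ v : ℝ, σ v = c₀ * (1 - c₁ * (1 + Real.tanh (-v / c₂)))) :
    ∀ v : ℝ, v * deriv σ v < σ v := by
  intro v
  have hinner : HasDerivAt (fun y : ℝ => -y / c₂) (-1 / c₂) v :=
    (hasDerivAt_id v).neg.div_const c₂
  have hderiv : HasDerivAt σ
      (c₀ * -(c₁ * (1 / Real.cosh (-v / c₂) ^ 2 * (-1 / c₂)))) v := by
    rw [funext hσ]
    exact (((((Real.hasDerivAt_tanh_inv_cosh_sq (-v / c₂)).comp v hinner).const_add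
      1).const_mul c₁).const_sub 1).const_mul c₀
  rw [hderiv.deriv, hσ v]
  have hbound := Real.tanh_sub_div_cosh_sq_lt_one (-v / c₂)
  have hfactor : v * (c₀ * -(c₁ * (1 / Real.cosh (-v / c₂) ^ 2 * (-1 / c₂))))
      = c₀ * (-c₁ * (-v / c₂ / Real.cosh (-v / c₂) ^ 2)) := by
    ring
  rw [hfactor]
  refine mul_lt_mul_of_pos_left ?_ hc₀
  linarith [mul_le_mul_of_nonneg_left hbound.le hc₁]
end

section
/- There exist real constants m and M with 0 < m ≤ M < ∞ such that for every v ∈ ℝ, m ≤ 1/σ(v) − v·σ'(v)/σ(v)² ≤ M, where σ' denotes the derivative of σ. (That is, σ given by the decompaction-weakening formula satisfies the infimum and supremum conditions of the paper's standing Assumptions on σ.) -/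
/-- The derivative of `tanh` is `1 - tanh²`. -/
theorem hasDerivAt_real_tanh (x : ℝ) :
    HasDerivAt Real.tanh (1 - Real.tanh x ^ 2) x := by
  have hc := (Real.cosh_pos x).ne'
  have h := (Real.hasDerivAt_sinh x).div (Real.hasDerivAt_cosh x) hc
  have hfun : Real.tanh = Real.sinh / Real.cosh := by
    ext y
    exact Real.tanh_eq_sinh_div_cosh y
  rw [hfun]
  refine h.congr_deriv ?_
  simp only [Pi.div_apply]
  field_simp

theorem mul_one_sub_tanh_le_one (x : ℝ) : x * (1 - Real.tanh x) ≤ 1 := by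
  have hp := Real.exp_pos x
  have hn := Real.exp_pos (-x)
  have hprod : Real.exp x * Real.exp (-x) = 1 := by
    rw [← Real.exp_add, add_neg_cancel, Real.exp_zero]
  have h2 := Real.add_one_le_exp (2 * x)
  have hsq : Real.exp (2 * x) * Real.exp (-x) = Real.exp x := by
    rw [← Real.exp_add]
    congr 1
    ring
  have heq : x * (1 - Real.tanh x) =
      2 * x * Real.exp (-x) / (Real.exp x + Real.exp (-x)) := by
    rw [Real.tanh_eq]
    field_simp
    ring
  rw [heq, div_le_one (by positivity)]
  nlinarith [mul_le_mul_of_nonneg_right h2 hn.le]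

theorem abs_tanh_sub_mul_one_sub_tanh_sq_le_one (x : ℝ) :
    |Real.tanh x - x * (1 - Real.tanh x ^ 2)| ≤ 1 := by
  have hl := Real.neg_one_lt_tanh x
  have hu := Real.tanh_lt_one x
  have h₁ := mul_one_sub_tanh_le_one x
  have h₂ := mul_one_sub_tanh_le_one (-x)
  rw [Real.tanh_neg] at h₂
  rw [abs_le]
  constructor
  · nlinarith [mul_le_mul_of_nonneg_right h₁ (by linarith : 0 ≤ 1 + Real.tanh x)]
  · nlinarith [mul_le_mul_of_nonneg_right h₂ (by linarith : 0 ≤ 1 - Real.tanh x)]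


/-- For `σ(v) = c₀ (1 - c₁ (1 + tanh(-v/c₂)))` with `c₀ > 0`,
`0 ≤ c₁ < 1/2` and `c₂ > 0`, there exist constants `0 < m ≤ M < ∞` such that
`m ≤ 1/σ(v) - v σ'(v)/σ(v)² ≤ M` for every `v ∈ ℝ`; i.e. this `σ` satisfies the
infimum and supremum conditions of the paper's standing assumptions. -/
theorem sigma_decompaction_assumption_bounds (c₀ c₁ c₂ : ℝ) (hc₀ : 0 < c₀)
    (hc₁ : 0 ≤ c₁) (hc₁' : c₁ < 1 / 2) (hc₂ : 0 < c₂) (σ : ℝ → ℝ)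
    (hσ : ∀ v : ℝ, σ v = c₀ * (1 - c₁ * (1 + Real.tanh (-v / c₂)))) :
    ∃ m M : ℝ, 0 < m ∧ m ≤ M ∧
      ∀ v : ℝ, m ≤ 1 / σ v - v * deriv σ v / (σ v) ^ 2 ∧
        1 / σ v - v * deriv σ v / (σ v) ^ 2 ≤ M := by
  have ha : 0 < 1 - 2 * c₁ := by linarith
  have hbounds : ∀ v : ℝ,
      (1 - 2 * c₁) / c₀ ≤ 1 / σ v - v * deriv σ v / (σ v) ^ 2 ∧
        1 / σ v - v * deriv σ v / (σ v) ^ 2 ≤ 1 / (c₀ * (1 - 2 * c₁) ^ 2) := by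
    intro v
    have hσ' : σ = fun v => c₀ * (1 - c₁ * (1 + Real.tanh (-v / c₂))) := funext hσ
    have hd : HasDerivAt σ
        (c₀ * (c₁ * ((1 - Real.tanh (v / c₂) ^ 2) / c₂))) v := by
      rw [hσ']
      have hlin : HasDerivAt (fun v : ℝ => -v / c₂) (-1 / c₂) v :=
        (hasDerivAt_id v).neg.div_const c₂
      have h := (((((hasDerivAt_real_tanh (-v / c₂)).comp v hlin).const_add 1).const_mul
        c₁).const_sub 1).const_mul c₀
      refine h.congr_deriv ?_
      rw [neg_div, Real.tanh_neg]
      ring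
    have hval : σ v = c₀ * (1 - c₁ + c₁ * Real.tanh (v / c₂)) := by
      rw [hσ, neg_div, Real.tanh_neg]
      ring
    rw [hd.deriv, hval]
    obtain ⟨hg₁, hg₂⟩ := abs_le.1 (abs_tanh_sub_mul_one_sub_tanh_sq_le_one (v / c₂))
    have hl := Real.neg_one_lt_tanh (v / c₂)
    have hu := Real.tanh_lt_one (v / c₂)
    set t := Real.tanh (v / c₂)
    set g := t - v / c₂ * (1 - t ^ 2) with hg
    have hD₁ : 1 - 2 * c₁ ≤ 1 - c₁ + c₁ * t := by nlinarith
    have hD₂ : 1 - c₁ + c₁ * t ≤ 1 := by nlinarith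
    have hN₁ : 1 - 2 * c₁ ≤ 1 - c₁ + c₁ * g := by nlinarith
    have hN₂ : 1 - c₁ + c₁ * g ≤ 1 := by nlinarith
    have hN : 1 - c₁ + c₁ * g = (1 - c₁ + c₁ * t) - c₁ * (v / c₂ * (1 - t ^ 2)) := by
      rw [hg]
      ring
    set D := 1 - c₁ + c₁ * t
    have hD : 0 < D := ha.trans_le hD₁
    have hexpr : 1 / (c₀ * D) - v * (c₀ * (c₁ * ((1 - t ^ 2) / c₂))) / (c₀ * D) ^ 2 =
        (1 - c₁ + c₁ * g) / (c₀ * D ^ 2) := by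
      rw [hN]
      field_simp
    rw [hexpr]
    constructor
    · have hDsq : D ^ 2 ≤ 1 := by nlinarith
      gcongr
      · exact ha.le.trans hN₁
      · nlinarith
    · gcongr
  exact ⟨_, _, div_pos ha hc₀, (hbounds 0).1.trans (hbounds 0).2, hbounds⟩
end

section
/- Suppose f : ℝ × ℝᵈ → ℝ satisfies ∇f(0,x) = 0 for all x ∈ cl(Ω), where ∇f(t,x) denotes the (possibly zero if nonexistent) Fréchet derivative of x ↦ f(t,x) at x. Then the first-order parabolic Hölder norm satisfies ‖f‖₁ ≤ (2 + T^{γ/2})·|f|₁ (as an inequality in [0,∞]). -/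
open Set
open scoped ENNReal

/-- `sup_{(t,x) ∈ [0,T] × cl Ω} |f(t,x)|`, as an element of `[0,∞]`. -/
noncomputable def supAbs {d : ℕ} (Ω : Set (EuclideanSpace ℝ (Fin d))) (T : ℝ)
    (f : ℝ → EuclideanSpace ℝ (Fin d) → ℝ) : ℝ≥0∞ :=
  ⨆ t ∈ Icc (0 : ℝ) T, ⨆ x ∈ closure Ω, ENNReal.ofReal |f t x|

/-- The spatial Hölder seminorm
`sup_{t ∈ [0,T], x₁ ≠ x₂ ∈ cl Ω} |f(t,x₁) - f(t,x₂)| / ‖x₁ - x₂‖^γ`. -/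
noncomputable def spaceHolderSemi {d : ℕ} (Ω : Set (EuclideanSpace ℝ (Fin d))) (T γ : ℝ)
    (f : ℝ → EuclideanSpace ℝ (Fin d) → ℝ) : ℝ≥0∞ :=
  ⨆ t ∈ Icc (0 : ℝ) T, ⨆ x₁ ∈ closure Ω, ⨆ x₂ ∈ closure Ω, ⨆ _ : x₁ ≠ x₂,
    ENNReal.ofReal (|f t x₁ - f t x₂| / ‖x₁ - x₂‖ ^ γ)

/-- The temporal Hölder seminorm with exponent `e`:
`sup_{t₁ ≠ t₂ ∈ [0,T], x ∈ cl Ω} |f(t₁,x) - f(t₂,x)| / |t₁ - t₂|^e`. -/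
noncomputable def timeHolderSemi {d : ℕ} (Ω : Set (EuclideanSpace ℝ (Fin d))) (T e : ℝ)
    (f : ℝ → EuclideanSpace ℝ (Fin d) → ℝ) : ℝ≥0∞ :=
  ⨆ t₁ ∈ Icc (0 : ℝ) T, ⨆ t₂ ∈ Icc (0 : ℝ) T, ⨆ _ : t₁ ≠ t₂, ⨆ x ∈ closure Ω,
    ENNReal.ofReal (|f t₁ x - f t₂ x| / |t₁ - t₂| ^ e)

/-- The parabolic Hölder norm `‖f‖₀` on `[0,T] × cl Ω`. -/
noncomputable def parabolicNorm0 {d : ℕ} (Ω : Set (EuclideanSpace ℝ (Fin d))) (T γ : ℝ)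
    (f : ℝ → EuclideanSpace ℝ (Fin d) → ℝ) : ℝ≥0∞ :=
  supAbs Ω T f + spaceHolderSemi Ω T γ f + timeHolderSemi Ω T (γ / 2) f

/-- The mixed Krylov-style seminorm
`sup_{(t₁,x₁) ≠ (t₂,x₂) ∈ Q} |f(t₁,x₁) - f(t₂,x₂)| / (‖x₁ - x₂‖^γ + |t₁ - t₂|^{γ/2})`. -/
noncomputable def krylovSemi {d : ℕ} (Ω : Set (EuclideanSpace ℝ (Fin d))) (T γ : ℝ)
    (f : ℝ → EuclideanSpace ℝ (Fin d) → ℝ) : ℝ≥0∞ :=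
  ⨆ t₁ ∈ Icc (0 : ℝ) T, ⨆ x₁ ∈ closure Ω, ⨆ t₂ ∈ Icc (0 : ℝ) T, ⨆ x₂ ∈ closure Ω,
    ⨆ _ : (t₁, x₁) ≠ (t₂, x₂),
    ENNReal.ofReal (|f t₁ x₁ - f t₂ x₂| / (‖x₁ - x₂‖ ^ γ + |t₁ - t₂| ^ (γ / 2)))

/-- The Krylov-style norm `|f|₀` on `[0,T] × cl Ω`. -/
noncomputable def krylovNorm0 {d : ℕ} (Ω : Set (EuclideanSpace ℝ (Fin d))) (T γ : ℝ)
    (f : ℝ → EuclideanSpace ℝ (Fin d) → ℝ) : ℝ≥0∞ :=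
  supAbs Ω T f + krylovSemi Ω T γ f

/-- `sup_{(t,x) ∈ [0,T] × cl Ω} ‖∇f(t,x)‖`, where `∇f(t,x)` is the Fréchet
derivative of `x ↦ f(t,x)` (zero where it does not exist). -/
noncomputable def supGrad {d : ℕ} (Ω : Set (EuclideanSpace ℝ (Fin d))) (T : ℝ)
    (f : ℝ → EuclideanSpace ℝ (Fin d) → ℝ) : ℝ≥0∞ :=
  ⨆ t ∈ Icc (0 : ℝ) T, ⨆ x ∈ closure Ω, ENNReal.ofReal ‖fderiv ℝ (f t) x‖

/-- The spatial Hölder seminorm of the gradient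
`sup_{t ∈ [0,T], x₁ ≠ x₂ ∈ cl Ω} ‖∇f(t,x₁) - ∇f(t,x₂)‖ / ‖x₁ - x₂‖^γ`. -/
noncomputable def spaceHolderGradSemi {d : ℕ} (Ω : Set (EuclideanSpace ℝ (Fin d)))
    (T γ : ℝ) (f : ℝ → EuclideanSpace ℝ (Fin d) → ℝ) : ℝ≥0∞ :=
  ⨆ t ∈ Icc (0 : ℝ) T, ⨆ x₁ ∈ closure Ω, ⨆ x₂ ∈ closure Ω, ⨆ _ : x₁ ≠ x₂,
    ENNReal.ofReal (‖fderiv ℝ (f t) x₁ - fderiv ℝ (f t) x₂‖ / ‖x₁ - x₂‖ ^ γ)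

/-- The temporal Hölder seminorm of the gradient with exponent `e`:
`sup_{t₁ ≠ t₂ ∈ [0,T], x ∈ cl Ω} ‖∇f(t₁,x) - ∇f(t₂,x)‖ / |t₁ - t₂|^e`. -/
noncomputable def timeHolderGradSemi {d : ℕ} (Ω : Set (EuclideanSpace ℝ (Fin d)))
    (T e : ℝ) (f : ℝ → EuclideanSpace ℝ (Fin d) → ℝ) : ℝ≥0∞ :=
  ⨆ t₁ ∈ Icc (0 : ℝ) T, ⨆ t₂ ∈ Icc (0 : ℝ) T, ⨆ _ : t₁ ≠ t₂, ⨆ x ∈ closure Ω,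
    ENNReal.ofReal (‖fderiv ℝ (f t₁) x - fderiv ℝ (f t₂) x‖ / |t₁ - t₂| ^ e)

/-- The mixed Krylov-style seminorm of the gradient:
`sup_{(t₁,x₁) ≠ (t₂,x₂) ∈ Q} ‖∇f(t₁,x₁) - ∇f(t₂,x₂)‖ / (‖x₁ - x₂‖^γ + |t₁ - t₂|^{γ/2})`. -/
noncomputable def krylovGradSemi {d : ℕ} (Ω : Set (EuclideanSpace ℝ (Fin d))) (T γ : ℝ)
    (f : ℝ → EuclideanSpace ℝ (Fin d) → ℝ) : ℝ≥0∞ :=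
  ⨆ t₁ ∈ Icc (0 : ℝ) T, ⨆ x₁ ∈ closure Ω, ⨆ t₂ ∈ Icc (0 : ℝ) T, ⨆ x₂ ∈ closure Ω,
    ⨆ _ : (t₁, x₁) ≠ (t₂, x₂),
    ENNReal.ofReal
      (‖fderiv ℝ (f t₁) x₁ - fderiv ℝ (f t₂) x₂‖ / (‖x₁ - x₂‖ ^ γ + |t₁ - t₂| ^ (γ / 2)))

/-- The first-order parabolic Hölder norm `‖f‖₁` on `[0,T] × cl Ω`. -/
noncomputable def parabolicNorm1 {d : ℕ} (Ω : Set (EuclideanSpace ℝ (Fin d))) (T γ : ℝ)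
    (f : ℝ → EuclideanSpace ℝ (Fin d) → ℝ) : ℝ≥0∞ :=
  supAbs Ω T f + supGrad Ω T f + spaceHolderGradSemi Ω T γ f +
    timeHolderSemi Ω T ((1 + γ) / 2) f + timeHolderGradSemi Ω T (γ / 2) f

/-- The first-order Krylov-style norm `|f|₁` on `[0,T] × cl Ω`. -/
noncomputable def krylovNorm1 {d : ℕ} (Ω : Set (EuclideanSpace ℝ (Fin d))) (T γ : ℝ)
    (f : ℝ → EuclideanSpace ℝ (Fin d) → ℝ) : ℝ≥0∞ :=
  supAbs Ω T f + krylovGradSemi Ω T γ f + timeHolderSemi Ω T ((1 + γ) / 2) f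

section GradientSeminorms

variable {d : ℕ} {Ω : Set (EuclideanSpace ℝ (Fin d))} {T γ : ℝ}
  {f : ℝ → EuclideanSpace ℝ (Fin d) → ℝ}

theorem ofReal_div_le_krylovGradSemi {t₁ t₂ : ℝ} {x₁ x₂ : EuclideanSpace ℝ (Fin d)}
    (ht₁ : t₁ ∈ Icc 0 T) (hx₁ : x₁ ∈ closure Ω) (ht₂ : t₂ ∈ Icc 0 T) (hx₂ : x₂ ∈ closure Ω)
    (hne : (t₁, x₁) ≠ (t₂, x₂)) :
    ENNReal.ofReal (‖fderiv ℝ (f t₁) x₁ - fderiv ℝ (f t₂) x₂‖ /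
      (‖x₁ - x₂‖ ^ γ + |t₁ - t₂| ^ (γ / 2))) ≤ krylovGradSemi Ω T γ f :=
  le_iSup₂_of_le t₁ ht₁ <| le_iSup₂_of_le x₁ hx₁ <| le_iSup₂_of_le t₂ ht₂ <|
    le_iSup₂_of_le x₂ hx₂ <| le_iSup_of_le hne le_rfl

theorem spaceHolderGradSemi_le_krylovGradSemi (hγ : 0 < γ) :
    spaceHolderGradSemi Ω T γ f ≤ krylovGradSemi Ω T γ f := by
  refine iSup₂_le fun t ht ↦ iSup₂_le fun x₁ hx₁ ↦ iSup₂_le fun x₂ hx₂ ↦ iSup_le fun hne ↦ ?_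
  simpa [Real.zero_rpow (half_pos hγ).ne'] using
    ofReal_div_le_krylovGradSemi (γ := γ) (f := f) ht hx₁ ht hx₂ (by simpa using hne)

theorem timeHolderGradSemi_le_krylovGradSemi (hγ : 0 < γ) :
    timeHolderGradSemi Ω T (γ / 2) f ≤ krylovGradSemi Ω T γ f := by
  refine iSup₂_le fun t₁ ht₁ ↦ iSup₂_le fun t₂ ht₂ ↦ iSup_le fun hne ↦ iSup₂_le fun x hx ↦ ?_
  simpa [Real.zero_rpow hγ.ne'] using
    ofReal_div_le_krylovGradSemi (γ := γ) (f := f) ht₁ hx ht₂ hx (by simpa using hne)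

theorem supGrad_le_mul_timeHolderGradSemi {e : ℝ} (he : 0 ≤ e)
    (hf0 : ∀ x ∈ closure Ω, fderiv ℝ (f 0) x = 0) :
    supGrad Ω T f ≤ ENNReal.ofReal (T ^ e) * timeHolderGradSemi Ω T e f := by
  refine iSup₂_le fun t ht ↦ iSup₂_le fun x hx ↦ ?_
  rcases ht.1.eq_or_lt with rfl | htpos
  · simp [hf0 x hx]
  have hquot : ENNReal.ofReal (‖fderiv ℝ (f t) x‖ / t ^ e) ≤ timeHolderGradSemi Ω T e f := by
    have h : ENNReal.ofReal (‖fderiv ℝ (f t) x - fderiv ℝ (f 0) x‖ / |t - 0| ^ e) ≤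
        timeHolderGradSemi Ω T e f :=
      le_iSup₂_of_le t ht <| le_iSup₂_of_le 0 ⟨le_rfl, ht.1.trans ht.2⟩ <|
        le_iSup_of_le htpos.ne' <| le_iSup₂_of_le x hx le_rfl
    simpa [hf0 x hx, abs_of_pos htpos] using h
  have hpow : 0 < t ^ e := Real.rpow_pos_of_pos htpos e
  calc ENNReal.ofReal ‖fderiv ℝ (f t) x‖
      = ENNReal.ofReal (t ^ e) * ENNReal.ofReal (‖fderiv ℝ (f t) x‖ / t ^ e) := by
        rw [← ENNReal.ofReal_mul hpow.le, mul_div_cancel₀ _ hpow.ne']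
    _ ≤ ENNReal.ofReal (T ^ e) * timeHolderGradSemi Ω T e f := by
        gcongr
        exact ht.2

end GradientSeminorms

/-- If `∇f(0,·) ≡ 0` on `cl Ω`, then the first-order parabolic
Hölder norm satisfies `‖f‖₁ ≤ (2 + T^{γ/2}) |f|₁`. -/
theorem parabolicNorm1_le_krylovNorm1 {d : ℕ} (hd : 1 ≤ d)
    (Ω : Set (EuclideanSpace ℝ (Fin d))) (hΩ : Ω.Nonempty) (T : ℝ) (hT : 0 < T)
    (γ : ℝ) (hγ0 : 0 < γ) (hγ1 : γ < 1)
    (f : ℝ → EuclideanSpace ℝ (Fin d) → ℝ)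
    (hf0 : ∀ x ∈ closure Ω, fderiv ℝ (f 0) x = 0) :
    parabolicNorm1 Ω T γ f ≤ ENNReal.ofReal (2 + T ^ (γ / 2)) * krylovNorm1 Ω T γ f := by
  have hTγ : 0 ≤ T ^ (γ / 2) := Real.rpow_nonneg hT.le _
  have hspace := spaceHolderGradSemi_le_krylovGradSemi (Ω := Ω) (T := T) (f := f) hγ0
  have htime := timeHolderGradSemi_le_krylovGradSemi (Ω := Ω) (T := T) (f := f) hγ0
  have hsup : supGrad Ω T f ≤ ENNReal.ofReal (T ^ (γ / 2)) * krylovGradSemi Ω T γ f :=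
    (supGrad_le_mul_timeHolderGradSemi (half_pos hγ0).le hf0).trans (by gcongr)
  have hone : 1 ≤ ENNReal.ofReal (2 + T ^ (γ / 2)) := by
    rw [ENNReal.one_le_ofReal]
    linarith
  unfold parabolicNorm1 krylovNorm1
  calc _ ≤ supAbs Ω T f + ENNReal.ofReal (T ^ (γ / 2)) * krylovGradSemi Ω T γ f +
          krylovGradSemi Ω T γ f + timeHolderSemi Ω T ((1 + γ) / 2) f +
          krylovGradSemi Ω T γ f := by gcongr
    _ = 1 * supAbs Ω T f + ENNReal.ofReal (2 + T ^ (γ / 2)) * krylovGradSemi Ω T γ f +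
          1 * timeHolderSemi Ω T ((1 + γ) / 2) f := by
        rw [ENNReal.ofReal_add zero_le_two hTγ, ENNReal.ofReal_ofNat]
        ring
    _ ≤ ENNReal.ofReal (2 + T ^ (γ / 2)) * supAbs Ω T f +
          ENNReal.ofReal (2 + T ^ (γ / 2)) * krylovGradSemi Ω T γ f +
          ENNReal.ofReal (2 + T ^ (γ / 2)) * timeHolderSemi Ω T ((1 + γ) / 2) f := by gcongr
    _ = _ := by ring
end

section
/- Assume additionally that Ω is convex, that cl(Ω) has diameter at most D > 0, and that 0 < T ≤ 1. Suppose f : ℝ × ℝᵈ → ℝ satisfies f(0,x) = 0 and ∇f(0,x) = 0 for all x ∈ cl(Ω), and for each t ∈ [0,T] the map x ↦ f(t,x) is differentiable at every point of cl(Ω). Then ‖f‖₀ ≤ max{2, D^{1−γ}}·T^{γ/2}·|f|₁ (as an inequality in [0,∞]). -/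
open Set
open scoped ENNReal

section Suprema

variable {d : ℕ} {Ω : Set (EuclideanSpace ℝ (Fin d))} {T γ e : ℝ}
  {f : ℝ → EuclideanSpace ℝ (Fin d) → ℝ}

theorem abs_le_toReal_supAbs (h : supAbs Ω T f ≠ ∞) {t : ℝ} (ht : t ∈ Icc (0 : ℝ) T)
    {x : EuclideanSpace ℝ (Fin d)} (hx : x ∈ closure Ω) : |f t x| ≤ (supAbs Ω T f).toReal := by
  rw [← ENNReal.ofReal_le_iff_le_toReal h]
  exact le_iSup₂_of_le t ht (le_iSup₂_of_le x hx le_rfl)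

theorem abs_sub_le_toReal_timeHolderSemi_mul (h : timeHolderSemi Ω T e f ≠ ∞)
    {t₁ t₂ : ℝ} (ht₁ : t₁ ∈ Icc (0 : ℝ) T) (ht₂ : t₂ ∈ Icc (0 : ℝ) T) (hne : t₁ ≠ t₂)
    {x : EuclideanSpace ℝ (Fin d)} (hx : x ∈ closure Ω) :
    |f t₁ x - f t₂ x| ≤ (timeHolderSemi Ω T e f).toReal * |t₁ - t₂| ^ e := by
  rw [← div_le_iff₀ (Real.rpow_pos_of_pos (abs_pos.2 (sub_ne_zero.2 hne)) _),
    ← ENNReal.ofReal_le_iff_le_toReal h]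
  exact le_iSup₂_of_le t₁ ht₁ (le_iSup₂_of_le t₂ ht₂ (le_iSup_of_le hne
    (le_iSup₂_of_le x hx le_rfl)))

theorem norm_fderiv_sub_le_toReal_krylovGradSemi_mul (hγ : γ ≠ 0)
    (h : krylovGradSemi Ω T γ f ≠ ∞)
    {t₁ t₂ : ℝ} (ht₁ : t₁ ∈ Icc (0 : ℝ) T) (ht₂ : t₂ ∈ Icc (0 : ℝ) T) (hne : t₁ ≠ t₂)
    {x : EuclideanSpace ℝ (Fin d)} (hx : x ∈ closure Ω) :
    ‖fderiv ℝ (f t₁) x - fderiv ℝ (f t₂) x‖ ≤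
      (krylovGradSemi Ω T γ f).toReal * |t₁ - t₂| ^ (γ / 2) := by
  rw [← div_le_iff₀ (Real.rpow_pos_of_pos (abs_pos.2 (sub_ne_zero.2 hne)) _),
    ← ENNReal.ofReal_le_iff_le_toReal h]
  refine le_iSup₂_of_le t₁ ht₁ (le_iSup₂_of_le x hx (le_iSup₂_of_le t₂ ht₂
    (le_iSup₂_of_le x hx (le_iSup_of_le (fun h => hne (congrArg Prod.fst h)) ?_))))
  simp [Real.zero_rpow hγ]

end Suprema

theorem div_rpow_le_weighted {v r γ : ℝ} (hv : 0 ≤ v) (hr : 0 < r) (hγ0 : 0 ≤ γ)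
    (hγ1 : γ ≤ 1) : v / r ^ γ ≤ γ * (v / r) + (1 - γ) * v := by
  refine le_trans (le_of_eq ?_) (Real.geom_mean_le_arith_mean2_weighted hγ0
    (sub_nonneg.2 hγ1) (div_nonneg hv hr.le) hv (by ring))
  rw [Real.div_rpow hv hr.le, div_mul_eq_mul_div, ← Real.rpow_add_of_nonneg hv hγ0
    (sub_nonneg.2 hγ1)]
  simp

theorem add_weighted_add_le {a b γ S K M : ℝ} (ha : 0 ≤ a) (hγ0 : 0 ≤ γ)
    (hγ1 : γ ≤ 1) (hba : b ≤ a) (hab : b ≤ a * (γ + (1 - γ) * b))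
    (hS : 0 ≤ S) (hK : 0 ≤ K) (hM : 0 ≤ M) (hSM : S ≤ M * (a * b)) :
    S + (γ * (K * a) + (1 - γ) * (2 * S)) + M * b ≤ 2 * a * (S + K + M) := by
  have hKa : 0 ≤ (2 - γ) * (K * a) := mul_nonneg (by linarith) (mul_nonneg hK ha)
  have haS : b * S ≤ a * S := mul_le_mul_of_nonneg_right hba hS
  have hq : (3 - 2 * γ - 2 * b) * S + M * b ≤ 2 * a * M := by
    rcases le_total 0 (3 - 2 * γ - 2 * b) with h | h
    · have h1 := mul_le_mul_of_nonneg_left hSM h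
      have h2 := mul_le_mul_of_nonneg_left hab hM
      have h3 : (3 - 2 * γ - 2 * b) * b + (γ + (1 - γ) * b) ≤ 2 := by
        nlinarith [mul_nonneg (sub_nonneg.2 hγ1) (sq_nonneg (1 - b)),
          mul_nonneg hγ0 (sq_nonneg (1 - 4 * b)), sq_nonneg (1 - b)]
      have h4 := mul_le_mul_of_nonneg_left h3 (mul_nonneg hM ha)
      linarith
    · have h1 := mul_nonneg (neg_nonneg.2 h) hS
      have h2 := mul_le_mul_of_nonneg_left hba hM
      have h3 := mul_nonneg hM ha
      linarith
  linarith

/-- Assume `Ω` is convex with `diam (cl Ω) ≤ D`, `0 < T ≤ 1`,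
`f(0,·) ≡ 0` and `∇f(0,·) ≡ 0` on `cl Ω`, and `x ↦ f(t,x)` is differentiable on
`cl Ω` for each `t ∈ [0,T]`. Then `‖f‖₀ ≤ max{2, D^{1-γ}} T^{γ/2} |f|₁`. -/
theorem parabolicNorm0_le_krylovNorm1 {d : ℕ} (hd : 1 ≤ d)
    (Ω : Set (EuclideanSpace ℝ (Fin d))) (hΩ : Ω.Nonempty) (hconv : Convex ℝ Ω)
    (D : ℝ) (hD : 0 < D) (hdiam : Metric.diam (closure Ω) ≤ D)
    (T : ℝ) (hT : 0 < T) (hT1 : T ≤ 1)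
    (γ : ℝ) (hγ0 : 0 < γ) (hγ1 : γ < 1)
    (f : ℝ → EuclideanSpace ℝ (Fin d) → ℝ)
    (hf0 : ∀ x ∈ closure Ω, f 0 x = 0)
    (hgrad0 : ∀ x ∈ closure Ω, fderiv ℝ (f 0) x = 0)
    (hdiff : ∀ t ∈ Icc (0 : ℝ) T, ∀ x ∈ closure Ω, DifferentiableAt ℝ (f t) x) :
    parabolicNorm0 Ω T γ f ≤
      ENNReal.ofReal (max 2 (D ^ (1 - γ)) * T ^ (γ / 2)) * krylovNorm1 Ω T γ f := by
  refine le_trans ?_ (mul_le_mul_left (ENNReal.ofReal_le_ofReal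
    (mul_le_mul_of_nonneg_right (le_max_left 2 (D ^ (1 - γ)))
      (Real.rpow_nonneg hT.le (γ / 2)))) (krylovNorm1 Ω T γ f))
  have ha : 0 < T ^ (γ / 2) := Real.rpow_pos_of_pos hT _
  by_cases htop : krylovNorm1 Ω T γ f = ∞
  · rw [htop, ENNReal.mul_top (by simpa using ha)]
    exact le_top
  have hfin := htop
  simp only [krylovNorm1, ENNReal.add_eq_top, not_or] at hfin
  obtain ⟨⟨hS, hK⟩, hM⟩ := hfin
  set S := (supAbs Ω T f).toReal with hSdef
  set K := (krylovGradSemi Ω T γ f).toReal with hKdef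
  set M := (timeHolderSemi Ω T ((1 + γ) / 2) f).toReal with hMdef
  have hS0 : 0 ≤ S := ENNReal.toReal_nonneg
  have hK0 : 0 ≤ K := ENNReal.toReal_nonneg
  have hM0 : 0 ≤ M := ENNReal.toReal_nonneg
  set a := T ^ (γ / 2) with hadef
  set b := T ^ (1 / 2 : ℝ) with hbdef
  have hb : 0 < b := Real.rpow_pos_of_pos hT _
  have hba : b ≤ a := Real.rpow_le_rpow_of_exponent_ge hT hT1 (by linarith)
  have h0 : (0 : ℝ) ∈ Icc (0 : ℝ) T := ⟨le_rfl, hT.le⟩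
  have hab : b ≤ a * (γ + (1 - γ) * b) := by
    have h := Real.geom_mean_le_arith_mean2_weighted hγ0.le (sub_nonneg.2 hγ1.le)
      zero_le_one hb.le (by ring)
    calc b = a * (1 ^ γ * b ^ (1 - γ)) := by
          rw [Real.one_rpow, one_mul, hbdef, hadef, ← Real.rpow_mul hT.le, ← Real.rpow_add hT]
          ring_nf
      _ ≤ a * (γ * 1 + (1 - γ) * b) := mul_le_mul_of_nonneg_left h ha.le
      _ = _ := by ring
  have hsup : ∀ t ∈ Icc (0 : ℝ) T, ∀ x ∈ closure Ω, |f t x| ≤ M * (a * b) := by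
    intro t ht x hx
    rcases eq_or_ne t 0 with rfl | hne
    · rw [hf0 x hx, abs_zero]
      positivity
    · have h := abs_sub_le_toReal_timeHolderSemi_mul hM ht h0 hne hx
      rw [hf0 x hx, sub_zero, sub_zero, abs_of_nonneg ht.1] at h
      refine h.trans (mul_le_mul_of_nonneg_left ?_ hM0)
      rw [hadef, hbdef, ← Real.rpow_add hT, ← add_div, add_comm γ 1]
      exact Real.rpow_le_rpow ht.1 ht.2 (by linarith)
  have hSM : S ≤ M * (a * b) := by
    refine ENNReal.toReal_le_of_le_ofReal (by positivity) ?_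
    exact iSup₂_le fun t ht => iSup₂_le fun x hx => ENNReal.ofReal_le_ofReal (hsup t ht x hx)
  have hgrad : ∀ t ∈ Icc (0 : ℝ) T, ∀ x ∈ closure Ω, ‖fderiv ℝ (f t) x‖ ≤ K * a := by
    intro t ht x hx
    rcases eq_or_ne t 0 with rfl | hne
    · rw [hgrad0 x hx, norm_zero]
      positivity
    · have h := norm_fderiv_sub_le_toReal_krylovGradSemi_mul hγ0.ne' hK ht h0 hne hx
      rw [hgrad0 x hx, sub_zero, sub_zero, abs_of_nonneg ht.1] at h
      exact h.trans (mul_le_mul_of_nonneg_left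
        (Real.rpow_le_rpow ht.1 ht.2 (by linarith)) hK0)
  have hspace : spaceHolderSemi Ω T γ f ≤
      ENNReal.ofReal (γ * (K * a) + (1 - γ) * (2 * S)) := by
    refine iSup₂_le fun t ht => iSup₂_le fun x₁ hx₁ => iSup₂_le fun x₂ hx₂ =>
      iSup_le fun hne => ENNReal.ofReal_le_ofReal ?_
    have hr : 0 < ‖x₁ - x₂‖ := norm_pos_iff.2 (sub_ne_zero.2 hne)
    have hlip : |f t x₁ - f t x₂| ≤ K * a * ‖x₁ - x₂‖ :=
      hconv.closure.norm_image_sub_le_of_norm_fderiv_le (hdiff t ht) (hgrad t ht) hx₂ hx₁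
    have hosc : |f t x₁ - f t x₂| ≤ 2 * S := by
      have h₁ := abs_le_toReal_supAbs hS ht hx₁
      have h₂ := abs_le_toReal_supAbs hS ht hx₂
      linarith [abs_sub (f t x₁) (f t x₂)]
    refine (div_rpow_le_weighted (abs_nonneg _) hr hγ0.le hγ1.le).trans ?_
    exact add_le_add (mul_le_mul_of_nonneg_left ((div_le_iff₀ hr).2 hlip) hγ0.le)
      (mul_le_mul_of_nonneg_left hosc (sub_nonneg.2 hγ1.le))
  have htime : timeHolderSemi Ω T (γ / 2) f ≤ ENNReal.ofReal (M * b) := by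
    refine iSup₂_le fun t₁ ht₁ => iSup₂_le fun t₂ ht₂ => iSup_le fun hne =>
      iSup₂_le fun x hx => ENNReal.ofReal_le_ofReal ?_
    have hpos : 0 < |t₁ - t₂| := abs_pos.2 (sub_ne_zero.2 hne)
    have hle : |t₁ - t₂| ≤ T :=
      abs_sub_le_iff.2 ⟨by linarith [ht₁.2, ht₂.1], by linarith [ht₂.2, ht₁.1]⟩
    rw [div_le_iff₀ (Real.rpow_pos_of_pos hpos _)]
    refine (abs_sub_le_toReal_timeHolderSemi_mul hM ht₁ ht₂ hne hx).trans ?_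
    rw [← hMdef, add_div, Real.rpow_add hpos, ← mul_assoc]
    gcongr
    exact Real.rpow_le_rpow hpos.le hle (by norm_num)
  calc parabolicNorm0 Ω T γ f
      ≤ ENNReal.ofReal S + ENNReal.ofReal (γ * (K * a) + (1 - γ) * (2 * S)) +
        ENNReal.ofReal (M * b) :=
        add_le_add (add_le_add (ENNReal.ofReal_toReal hS).ge hspace) htime
    _ = ENNReal.ofReal (S + (γ * (K * a) + (1 - γ) * (2 * S)) + M * b) := by
        have h : 0 ≤ γ * (K * a) + (1 - γ) * (2 * S) := by
          have := sub_nonneg.2 hγ1.le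
          positivity
        rw [ENNReal.ofReal_add (add_nonneg hS0 h) (by positivity), ENNReal.ofReal_add hS0 h]
    _ ≤ ENNReal.ofReal (2 * a * (S + K + M)) := ENNReal.ofReal_le_ofReal
        (add_weighted_add_le ha.le hγ0.le hγ1.le hba hab hS0 hK0 hM0 hSM)
    _ = ENNReal.ofReal (2 * a) * krylovNorm1 Ω T γ f := by
        rw [ENNReal.ofReal_mul (by positivity), ENNReal.ofReal_add (by positivity) hM0,
          ENNReal.ofReal_add hS0 hK0, hSdef, hKdef, hMdef, ENNReal.ofReal_toReal hS,
          ENNReal.ofReal_toReal hK, ENNReal.ofReal_toReal hM, krylovNorm1]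
end

section
/- Let f : ℝ × ℝᵈ → ℝ be such that for every x ∈ cl(Ω) the map s ↦ f(s,x) is continuous on [0,T], and define F : ℝ × ℝᵈ → ℝ by F(t,x) = ∫₀ᵗ f(s,x) ds. Then the parabolic Hölder norm of the time integral satisfies ‖F‖₀ ≤ (1 + T^{γ/2})·T^{1−γ/2}·‖f‖₀ (as an inequality in [0,∞]). -/
open Set
open scoped ENNReal

/-- A bound on the absolute value of the integrand on `[a,b]` bounds the interval integral. -/
theorem ofReal_abs_intervalIntegral_le {g : ℝ → ℝ} {a b : ℝ} {M : ℝ≥0∞}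
    (hg : ∀ s ∈ uIcc a b, ENNReal.ofReal |g s| ≤ M) :
    ENNReal.ofReal |∫ s in a..b, g s| ≤ ENNReal.ofReal |b - a| * M := by
  rw [← Real.norm_eq_abs, intervalIntegral.norm_intervalIntegral_eq, ofReal_norm]
  calc ‖∫ s in uIoc a b, g s‖ₑ
      ≤ ∫⁻ s in uIoc a b, ‖g s‖ₑ := MeasureTheory.enorm_integral_le_lintegral_enorm _
    _ ≤ ∫⁻ _ in uIoc a b, M := by
        refine MeasureTheory.setLIntegral_mono measurable_const fun s hs => ?_
        rw [← ofReal_norm, Real.norm_eq_abs]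
        exact hg s (uIoc_subset_uIcc hs)
    _ = ENNReal.ofReal |b - a| * M := by
        rw [MeasureTheory.setLIntegral_const, Real.volume_uIoc, mul_comm]

theorem ofReal_abs_le_supAbs {d : ℕ} {Ω : Set (EuclideanSpace ℝ (Fin d))} {T : ℝ}
    (f : ℝ → EuclideanSpace ℝ (Fin d) → ℝ) {t : ℝ} (ht : t ∈ Icc (0 : ℝ) T)
    {x : EuclideanSpace ℝ (Fin d)} (hx : x ∈ closure Ω) :
    ENNReal.ofReal |f t x| ≤ supAbs Ω T f :=
  le_iSup₂_of_le t ht <| le_iSup₂_of_le x hx le_rfl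

theorem ofReal_div_le_spaceHolderSemi {d : ℕ} {Ω : Set (EuclideanSpace ℝ (Fin d))} {T : ℝ}
    (γ : ℝ) (f : ℝ → EuclideanSpace ℝ (Fin d) → ℝ) {t : ℝ} (ht : t ∈ Icc (0 : ℝ) T)
    {x y : EuclideanSpace ℝ (Fin d)} (hx : x ∈ closure Ω) (hy : y ∈ closure Ω) (hxy : x ≠ y) :
    ENNReal.ofReal (|f t x - f t y| / ‖x - y‖ ^ γ) ≤ spaceHolderSemi Ω T γ f :=
  le_iSup₂_of_le t ht <| le_iSup₂_of_le x hx <| le_iSup₂_of_le y hy <| le_iSup_of_le hxy le_rfl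

theorem supAbs_timeIntegral_le {d : ℕ} (Ω : Set (EuclideanSpace ℝ (Fin d))) (T : ℝ)
    (f : ℝ → EuclideanSpace ℝ (Fin d) → ℝ) :
    supAbs Ω T (fun t x => ∫ s in (0 : ℝ)..t, f s x) ≤ ENNReal.ofReal T * supAbs Ω T f := by
  refine iSup₂_le fun t ht => iSup₂_le fun x hx => ?_
  refine (ofReal_abs_intervalIntegral_le (M := supAbs Ω T f) fun s hs => ?_).trans ?_
  · exact ofReal_abs_le_supAbs f (uIcc_subset_Icc ⟨le_rfl, ht.1.trans ht.2⟩ ht hs) hx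
  · gcongr
    rw [sub_zero, abs_of_nonneg ht.1]
    exact ht.2

theorem spaceHolderSemi_timeIntegral_le {d : ℕ} (Ω : Set (EuclideanSpace ℝ (Fin d))) (T γ : ℝ)
    (f : ℝ → EuclideanSpace ℝ (Fin d) → ℝ)
    (hf : ∀ x ∈ closure Ω, ContinuousOn (fun s => f s x) (Icc (0 : ℝ) T)) :
    spaceHolderSemi Ω T γ (fun t x => ∫ s in (0 : ℝ)..t, f s x) ≤
      ENNReal.ofReal T * spaceHolderSemi Ω T γ f := by
  refine iSup₂_le fun t ht => iSup₂_le fun x hx => iSup₂_le fun y hy => iSup_le fun hxy => ?_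
  have hsub : uIcc 0 t ⊆ Icc 0 T := uIcc_subset_Icc ⟨le_rfl, ht.1.trans ht.2⟩ ht
  have hpow : 0 ≤ ‖x - y‖ ^ γ := by positivity
  rw [← intervalIntegral.integral_sub ((hf x hx).mono hsub).intervalIntegrable
      ((hf y hy).mono hsub).intervalIntegrable, ← abs_of_nonneg hpow, ← abs_div,
    ← intervalIntegral.integral_div]
  refine (ofReal_abs_intervalIntegral_le (M := spaceHolderSemi Ω T γ f) fun s hs => ?_).trans ?_
  · rw [abs_div, abs_of_nonneg hpow]
    exact ofReal_div_le_spaceHolderSemi γ f (hsub hs) hx hy hxy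
  · gcongr
    rw [sub_zero, abs_of_nonneg ht.1]
    exact ht.2

theorem timeHolderSemi_timeIntegral_le {d : ℕ} (Ω : Set (EuclideanSpace ℝ (Fin d))) (T : ℝ)
    {e : ℝ} (he : e ≤ 1) (f : ℝ → EuclideanSpace ℝ (Fin d) → ℝ)
    (hf : ∀ x ∈ closure Ω, ContinuousOn (fun s => f s x) (Icc (0 : ℝ) T)) :
    timeHolderSemi Ω T e (fun t x => ∫ s in (0 : ℝ)..t, f s x) ≤
      ENNReal.ofReal (T ^ (1 - e)) * supAbs Ω T f := by
  refine iSup₂_le fun t ht => iSup₂_le fun u hu => iSup_le fun htu => iSup₂_le fun x hx => ?_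
  have h0 : (0 : ℝ) ∈ Icc 0 T := ⟨le_rfl, ht.1.trans ht.2⟩
  have hint : ∀ v ∈ Icc 0 T, IntervalIntegrable (fun s => f s x) MeasureTheory.volume 0 v :=
    fun v hv => ((hf x hx).mono (uIcc_subset_Icc h0 hv)).intervalIntegrable
  have hpos : 0 < |t - u| := abs_pos.2 (sub_ne_zero.2 htu)
  rw [intervalIntegral.integral_interval_sub_left (hint t ht) (hint u hu),
    ENNReal.ofReal_div_of_pos (Real.rpow_pos_of_pos hpos e)]
  calc ENNReal.ofReal |∫ s in u..t, f s x| / ENNReal.ofReal (|t - u| ^ e)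
      ≤ ENNReal.ofReal |t - u| * supAbs Ω T f / ENNReal.ofReal (|t - u| ^ e) := by
        gcongr
        exact ofReal_abs_intervalIntegral_le fun s hs =>
          ofReal_abs_le_supAbs f (uIcc_subset_Icc hu ht hs) hx
    _ = ENNReal.ofReal (|t - u| ^ (1 - e)) * supAbs Ω T f := by
        rw [ENNReal.mul_div_right_comm, ← ENNReal.ofReal_div_of_pos (Real.rpow_pos_of_pos hpos e),
          Real.rpow_sub hpos, Real.rpow_one]
    _ ≤ ENNReal.ofReal (T ^ (1 - e)) * supAbs Ω T f := by
        have hle : |t - u| ≤ T :=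
          abs_sub_le_iff.2 ⟨by linarith [ht.2, hu.1], by linarith [hu.2, ht.1]⟩
        have := Real.rpow_le_rpow hpos.le hle (sub_nonneg.2 he)
        gcongr

/-- If `s ↦ f(s,x)` is continuous on `[0,T]` for each
`x ∈ cl Ω`, and `F(t,x) = ∫₀ᵗ f(s,x) ds`, then
`‖F‖₀ ≤ (1 + T^{γ/2}) T^{1-γ/2} ‖f‖₀`. -/
theorem parabolicNorm0_timeIntegral_le {d : ℕ} (hd : 1 ≤ d)
    (Ω : Set (EuclideanSpace ℝ (Fin d))) (hΩ : Ω.Nonempty) (T : ℝ) (hT : 0 < T)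
    (γ : ℝ) (hγ0 : 0 < γ) (hγ1 : γ < 1)
    (f : ℝ → EuclideanSpace ℝ (Fin d) → ℝ)
    (hf : ∀ x ∈ closure Ω, ContinuousOn (fun s => f s x) (Icc (0 : ℝ) T))
    (F : ℝ → EuclideanSpace ℝ (Fin d) → ℝ)
    (hF : ∀ t : ℝ, ∀ x, F t x = ∫ s in (0 : ℝ)..t, f s x) :
    parabolicNorm0 Ω T γ F ≤
      ENNReal.ofReal ((1 + T ^ (γ / 2)) * T ^ (1 - γ / 2)) * parabolicNorm0 Ω T γ f := by
  obtain rfl : F = fun t x => ∫ s in (0 : ℝ)..t, f s x := funext₂ hF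
  have hconst : ENNReal.ofReal ((1 + T ^ (γ / 2)) * T ^ (1 - γ / 2)) =
      ENNReal.ofReal T + ENNReal.ofReal (T ^ (1 - γ / 2)) := by
    rw [← ENNReal.ofReal_add hT.le (by positivity), add_mul, ← Real.rpow_add hT,
      add_sub_cancel, Real.rpow_one, one_mul, add_comm]
  rw [hconst]
  set K := ENNReal.ofReal T
  set L := ENNReal.ofReal (T ^ (1 - γ / 2))
  calc parabolicNorm0 Ω T γ (fun t x => ∫ s in (0 : ℝ)..t, f s x)
      ≤ K * supAbs Ω T f + K * spaceHolderSemi Ω T γ f + L * supAbs Ω T f :=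
        add_le_add (add_le_add (supAbs_timeIntegral_le Ω T f)
          (spaceHolderSemi_timeIntegral_le Ω T γ f hf))
          (timeHolderSemi_timeIntegral_le Ω T (by linarith) f hf)
    _ = K * (supAbs Ω T f + spaceHolderSemi Ω T γ f) + L * supAbs Ω T f := by rw [mul_add]
    _ ≤ K * parabolicNorm0 Ω T γ f + L * parabolicNorm0 Ω T γ f := by
        gcongr
        · exact le_self_add
        · exact le_self_add.trans le_self_add
    _ = (K + L) * parabolicNorm0 Ω T γ f := (add_mul _ _ _).symm
end

section
/- Let E be a real normed vector space, n ∈ ℕ, and let κ : ℝ → ℝ be (n+1)-times differentiable on ℝ, with κ^{(k)} denoting its k-th derivative. Let u, w : E → ℝ be differentiable at a point p ∈ E and continuous on a neighborhood of p, with u(p) ≠ w(p). Define, on the set where u ≠ w, G(x) = (κ(w(x)) − Σ_{k=0}^{n} κ^{(k)}(u(x))·(w(x) − u(x))^k / k!) / (u(x) − w(x))^{n+1}. Then G is differentiable at p, and its Fréchet derivative at p equals −(n+1)/(u(p) − w(p))^{n+2} · (Du(p) − Dw(p)) · (κ(w(p)) − Σ_{k=0}^{n+1} κ^{(k)}(u(p))·(w(p)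 − u(p))^k / k!) + 1/(u(p) − w(p))^{n+1} · Dw(p) · (κ'(w(p)) − Σ_{k=0}^{n} κ^{(k+1)}(u(p))·(w(p) − u(p))^k / k!), where Du(p), Dw(p) denote the Fréchet derivatives of u and w at p. -/
open Finset

/-- Differentiating a Taylor polynomial in both its base point and its argument: the derivative in
the base point telescopes. -/
theorem hasFDerivAt_taylor_sum {E : Type*} [NormedAddCommGroup E] [NormedSpace ℝ E] (n : ℕ)
    (κ : ℝ → ℝ) {u w : E → ℝ} {u' w' : E →L[ℝ] ℝ} {p : E}
    (hκ : ∀ k ≤ n, DifferentiableAt ℝ (iteratedDeriv k κ) (u p))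
    (hu : HasFDerivAt u u' p) (hw : HasFDerivAt w w' p) :
    HasFDerivAt
      (fun x => ∑ k ∈ range (n + 1),
        iteratedDeriv k κ (u x) * (w x - u x) ^ k / (Nat.factorial k : ℝ))
      ((iteratedDeriv (n + 1) κ (u p) * (w p - u p) ^ n / (Nat.factorial n : ℝ)) • u' +
        (∑ k ∈ range n,
          iteratedDeriv (k + 1) κ (u p) * (w p - u p) ^ k / (Nat.factorial k : ℝ)) • w') p := by
  have hcomp : ∀ k ≤ n, HasFDerivAt (fun x => iteratedDeriv k κ (u x))
      (iteratedDeriv (k + 1) κ (u p) • u') p := fun k hk => by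
    rw [iteratedDeriv_succ]
    exact (hκ k hk).hasDerivAt.comp_hasFDerivAt p hu
  induction n with
  | zero => simpa using hcomp 0 le_rfl
  | succ n ih =>
    have hsum := ih (fun k hk => hκ k (by omega)) (fun k hk => hcomp k (by omega))
    have hterm := ((hcomp (n + 1) le_rfl).mul ((hw.sub hu).pow (n + 1))).mul_const
      ((Nat.factorial (n + 1) : ℝ)⁻¹)
    simp only [sum_range_succ _ (n + 1), div_eq_mul_inv] at hsum ⊢
    refine (hsum.add hterm).congr_fderiv ?_
    have hfact : (Nat.factorial n : ℝ) ≠ 0 := by positivity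
    ext v
    simp [sum_range_succ _ n, Nat.factorial_succ]
    field_simp
    ring

/-- Let `κ : ℝ → ℝ` be `(n+1)`-times differentiable, and let
`u w : E → ℝ` be differentiable at `p` and continuous near `p`, with
`u(p) ≠ w(p)`. Then the function
`G(x) = (κ(w x) - ∑_{k=0}^{n} κ^{(k)}(u x) (w x - u x)^k / k!) / (u x - w x)^{n+1}`
is differentiable at `p` with the stated Fréchet derivative. -/
theorem hasFDerivAt_taylor_remainder_quotient {E : Type*} [NormedAddCommGroup E]
    [NormedSpace ℝ E] (n : ℕ) (κ : ℝ → ℝ)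
    (hκ : ∀ k ≤ n, Differentiable ℝ (iteratedDeriv k κ))
    (u w : E → ℝ) (p : E)
    (hu : DifferentiableAt ℝ u p) (hw : DifferentiableAt ℝ w p)
    (hucont : ∃ s ∈ nhds p, ContinuousOn u s)
    (hwcont : ∃ s ∈ nhds p, ContinuousOn w s)
    (hne : u p ≠ w p)
    (G : E → ℝ)
    (hG : ∀ x : E, u x ≠ w x →
      G x = (κ (w x) -
          ∑ k ∈ range (n + 1),
            iteratedDeriv k κ (u x) * (w x - u x) ^ k / (Nat.factorial k : ℝ)) /
        (u x - w x) ^ (n + 1)) :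
    HasFDerivAt G
      ((-((n : ℝ) + 1) / (u p - w p) ^ (n + 2) *
          (κ (w p) -
            ∑ k ∈ range (n + 2),
              iteratedDeriv k κ (u p) * (w p - u p) ^ k / (Nat.factorial k : ℝ))) •
          (fderiv ℝ u p - fderiv ℝ w p) +
        (1 / (u p - w p) ^ (n + 1) *
          (deriv κ (w p) -
            ∑ k ∈ range (n + 1),
              iteratedDeriv (k + 1) κ (u p) * (w p - u p) ^ k / (Nat.factorial k : ℝ))) •
          fderiv ℝ w p) p := by
  have hu' := hu.hasFDerivAt
  have hw' := hw.hasFDerivAt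
  have hκ0 : Differentiable ℝ κ := by simpa using hκ 0 (Nat.zero_le n)
  have hd : u p - w p ≠ 0 := sub_ne_zero.mpr hne
  have hfact : (Nat.factorial n : ℝ) ≠ 0 := by positivity
  have hnum := ((hκ0 (w p)).hasDerivAt.comp_hasFDerivAt p hw').sub
    (hasFDerivAt_taylor_sum n κ (fun k hk => hκ k hk (u p)) hu' hw')
  have hquot := hnum.mul
    ((hasDerivAt_inv (pow_ne_zero (n + 1) hd)).comp_hasFDerivAt p ((hu'.sub hw').pow (n + 1)))
  refine (hquot.congr_of_eventuallyEq
    (((hu.continuousAt.ne_iff_eventually_ne hw.continuousAt).mp hne).mono fun x hx =>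
      (hG x hx).trans (div_eq_mul_inv _ _))).congr_fderiv ?_
  have hswap : w p - u p = -(u p - w p) := by ring
  ext v
  simp [sum_range_succ _ (n + 1), sum_range_succ _ n, Nat.factorial_succ]
  rw [hswap]
  generalize u p - w p = d at *
  field_simp
  ring
end
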